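/- Let K be a difference subfield of U with σ(K) = K, and a a finite tuple with σ(a) ∈ K(a)^alg and μ(σ(a)/K(a)) = ld(a/K). Let m := sup_{ℓ≥1} μ(σ(a)/K(a,σ^ℓ(a))), let ℓ0 be the least ℓ ≥ 1 at which this supremum is attained, and let C := μ((σ(a),…,σ^{ℓ0−1}(a))/K(a,σ^{ℓ0}(a))). Then for every ℓ ≥ ℓ0, μ(σ^ℓ(a)/K(a))·C·m^{ℓ−ℓ0} = ld(a/K)^ℓ; consequently the limit dd(a/K) = lim_{ℓ→∞} μ(σ^ℓ(a)/K(a))^{1/ℓ} exists and equals ld(a/K)/m. -/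

import Mathlib

/- Setting: a large algebraically closed field `U` with an automorphism `σ`.
   Tuples are maps `Fin n → U`; for a tuple `t`, the relevant set of coordinates
   is `Set.range t`.  `fAdj E s` is the subfield `E(s)` generated by a subfield
   `E` and a set `s`, and `deg E s` is the degree `μ(s/E) = [E(s):E]`. -/

set_option maxHeartbeats 1000000
set_option synthInstance.maxHeartbeats 1000000

open Filter Set

variable {U : Type*}

/-- The subfield `E(s)` generated by the subfield `E` and the set `s`. -/
noncomputable def fAdj [Field U] (E : Subfield U) (s : Set U) : Subfield U :=
  (IntermediateField.adjoin E s).toSubfield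

/-- The degree `μ(s/E) = [E(s):E]` (as `Module.finrank`; it is `0` when infinite). -/
noncomputable def deg [Field U] (E : Subfield U) (s : Set U) : ℕ :=
  Module.finrank E (IntermediateField.adjoin E s)

/-- `k ↦ μ(σ^{k+1}(s) / K(s, σ(s), …, σ^k(s)))`: the sequence whose eventual
value is the limit degree `ld(s/K)`. -/
noncomputable def ldSeq [Field U] (σ : U ≃+* U) (K : Subfield U) (s : Set U) (k : ℕ) : ℕ :=
  deg (fAdj K (⋃ i ∈ Set.Iic k, ⇑(σ ^ i) '' s)) (⇑(σ ^ (k + 1)) '' s)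

/-- `k ↦ μ(σ^k(s) / K(s))`: the sequence whose `k`-th roots converge to the
distant degree `dd(s/K)`. -/
noncomputable def ddSeq [Field U] (σ : U ≃+* U) (K : Subfield U) (s : Set U) (k : ℕ) : ℕ :=
  deg (fAdj K s) (⇑(σ ^ k) '' s)

/-- The inversive closure `K^inv = ⋃ₙ σ^{-n}(K)`. -/
noncomputable def Kinv [Field U] (σ : U ≃+* U) (K : Subfield U) : Subfield U :=
  ⨆ n : ℕ, K.map (σ⁻¹ ^ n : U ≃+* U).toRingHom

/-- The difference field `K(s)_σ = K(σ^i(s) : i ∈ ℕ)` generated by `s` over `K`. -/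
noncomputable def diffAdj [Field U] (σ : U ≃+* U) (K : Subfield U) (s : Set U) : Subfield U :=
  fAdj K (⋃ i : ℕ, ⇑(σ ^ i) '' s)

section ShiftDegree

/-- The formal properties of `(I, J) ↦ [K(σ^i(s) : i ∈ I ∪ J) : K(σ^i(s) : i ∈ I)]`:
multiplicativity in towers, invariance under the shift, and monotonicity under base change. -/
structure IsShiftDegree (d : Set ℕ → Set ℕ → ℕ) : Prop where
  empty : ∀ I, d I ∅ = 1
  union : ∀ I J J', d I (J ∪ J') = d I J * d (I ∪ J) J'
  shift : ∀ I J, d (Nat.succ '' I) (Nat.succ '' J) = d I J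
  pos_and_le : ∀ I I' J, I ⊆ I' → 0 < d I J → 0 < d I' J ∧ d I' J ≤ d I J

namespace IsShiftDegree

variable {d : Set ℕ → Set ℕ → ℕ} {L : ℕ}

theorem singleton_succ (hd : IsShiftDegree d) (k : ℕ) : d {k} {k + 1} = d {0} {1} := by
  induction k with
  | zero => rfl
  | succ k ih => rw [← ih, ← hd.shift {k} {k + 1}]; simp

theorem Iic_eq_of_eventually (hd : IsShiftDegree d) (hL : 0 < L) (h0 : d {0} {1} = L)
    (hev : ∀ᶠ k in atTop, d (Iic k) {k + 1} = L) (k : ℕ) : d (Iic k) {k + 1} = L := by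
  have key : ∀ k, 0 < d (Iic k) {k + 1} ∧ d (Iic k) {k + 1} ≤ L := by
    intro k
    have h := hd.singleton_succ k
    rw [h0] at h
    have := hd.pos_and_le {k} (Iic k) {k + 1} (by simp) (by omega)
    omega
  have anti : Antitone fun k => d (Iic k) {k + 1} := by
    refine antitone_nat_of_succ_le fun k => ?_
    have h := hd.pos_and_le (Nat.succ '' Iic k) (Iic (k + 1)) (Nat.succ '' {k + 1})
      (by rintro _ ⟨x, hx, rfl⟩; simp only [mem_Iic] at *; omega)
      (by rw [hd.shift]; exact (key k).1)
    rw [hd.shift] at h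
    simpa using h.2
  obtain ⟨N, hN⟩ := eventually_atTop.1 hev
  have h1 := anti (le_max_left k N)
  have h2 := hN _ (le_max_right k N)
  simp only at h1
  have := (key k).2
  omega

theorem eq_of_mem (hd : IsShiftDegree d) (hL : 0 < L) (h : ∀ k, d (Iic k) {k + 1} = L)
    {I : Set ℕ} {k : ℕ} (hI : I ⊆ Iic k) (hk : k ∈ I) : d I {k + 1} = L := by
  have h0 : d {0} {1} = L := by
    rw [← h 0]; congr 1; ext; simp
  have h1 := hd.singleton_succ k
  rw [h0] at h1
  have h2 := hd.pos_and_le {k} I {k + 1} (by simpa) (by omega)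
  have h3 := hd.pos_and_le I (Iic k) {k + 1} hI h2.1
  have := h k
  omega

theorem Icc_eq_pow (hd : IsShiftDegree d) (hL : 0 < L) (h : ∀ k, d (Iic k) {k + 1} = L)
    {I : Set ℕ} {k : ℕ} (hI : I ⊆ Iic k) (hk : k ∈ I) (j : ℕ) :
    d I (Icc (k + 1) (k + j)) = L ^ j := by
  induction j with
  | zero => simp [hd.empty]
  | succ j ih =>
    have e : Icc (k + 1) (k + (j + 1)) = Icc (k + 1) (k + j) ∪ {k + j + 1} := by
      ext x; simp only [mem_Icc, mem_union, mem_singleton_iff]; omega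
    rw [e, hd.union, ih, pow_succ, hd.eq_of_mem hL h]
    · rintro x (hx | hx)
      · have := hI hx
        simp only [mem_Iic] at *; omega
      · simp only [mem_Icc, mem_Iic] at *; omega
    · rcases Nat.eq_zero_or_pos j with rfl | hj
      · exact Or.inl hk
      · exact Or.inr (by simp only [mem_Icc]; omega)

theorem mul_eq_pow (hd : IsShiftDegree d) (hL : 0 < L) (h : ∀ k, d (Iic k) {k + 1} = L)
    {I : Set ℕ} {k : ℕ} (hI : I ⊆ Iic k) (hk : k ∈ I) (j : ℕ) :
    d I {k + j + 1} * d (I ∪ {k + j + 1}) (Icc (k + 1) (k + j)) = L ^ (j + 1) := by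
  rw [← hd.union, ← hd.Icc_eq_pow hL h hI hk]
  congr 1
  ext x; simp only [mem_Icc, mem_union, mem_singleton_iff]; omega

theorem Icc_succ_eq_mul (hd : IsShiftDegree d) (hL : 0 < L) (h : ∀ k, d (Iic k) {k + 1} = L)
    (j : ℕ) : d ({0} ∪ {j + 2}) (Icc 1 (j + 1)) =
      d ({0} ∪ {j + 2}) {1} * d ({0} ∪ {j + 1}) (Icc 1 j) := by
  have e : Icc 1 (j + 1) = {1} ∪ Icc 2 (1 + j) := by
    ext x; simp only [mem_Icc, mem_union, mem_singleton_iff]; omega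
  have e1 : ({0} ∪ {j + 2} ∪ {1} : Set ℕ) = {0, 1} ∪ {1 + j + 1} := by
    ext x; simp only [mem_insert_iff, mem_union, mem_singleton_iff]; omega
  have h1 := hd.mul_eq_pow hL h (I := {0, 1}) (k := 1)
    (by rintro x (rfl | rfl) <;> simp) (by simp) j
  have h2 := hd.mul_eq_pow hL h (I := {1}) (k := 1) (by simp) (by simp) j
  have hp : 0 < L ^ (j + 1) := pow_pos hL _
  obtain ⟨ha, hb⟩ : 0 < d {1} {1 + j + 1} ∧
      0 < d ({1} ∪ {1 + j + 1}) (Icc (1 + 1) (1 + j)) := by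
    rw [← h2] at hp
    exact ⟨Nat.pos_of_mul_pos_right hp, Nat.pos_of_mul_pos_left hp⟩
  have h3 := hd.pos_and_le {1} {0, 1} {1 + j + 1} (by simp) ha
  have h4 := hd.pos_and_le ({1} ∪ {1 + j + 1}) ({0, 1} ∪ {1 + j + 1}) (Icc (1 + 1) (1 + j))
    (union_subset_union_left _ (by simp)) hb
  have h5 : d ({0, 1} ∪ {1 + j + 1}) (Icc (1 + 1) (1 + j)) =
      d ({1} ∪ {1 + j + 1}) (Icc (1 + 1) (1 + j)) := by
    refine le_antisymm h4.2 ?_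
    rw [← h2] at h1
    refine Nat.le_of_mul_le_mul_left ?_ ha
    rw [← h1]
    exact Nat.mul_le_mul_right _ h3.2
  have h6 := hd.shift ({0} ∪ {j + 1}) (Icc 1 j)
  have e2 : Nat.succ '' Icc 1 j = Icc (1 + 1) (1 + j) := by
    ext x; simp only [mem_image, mem_Icc]
    exact ⟨by rintro ⟨y, hy, rfl⟩; omega, fun hx => ⟨x - 1, by omega, by omega⟩⟩
  have e3 : Nat.succ '' ({0} ∪ {j + 1}) = {1} ∪ {1 + j + 1} := by
    simp [image_union, add_comm]
  rw [e2, e3] at h6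
  rw [e, hd.union, e1, ← h6, ← h5]

theorem le_succ (hd : IsShiftDegree d) (hL : 0 < L) (h : ∀ k, d (Iic k) {k + 1} = L)
    (j : ℕ) : d ({0} ∪ {j + 1}) {1} ≤ d ({0} ∪ {j + 2}) {1} := by
  have h0 : d {0} {1} = L := hd.eq_of_mem hL h (k := 0) (by simp) (by simp)
  have h1 := hd.union ({0} ∪ {j + 1}) {1} {j + 2}
  have h2 := hd.union ({0} ∪ {j + 1}) {j + 2} {1}
  rw [hd.eq_of_mem hL h (k := j + 1)
    (by rintro x (hx | hx) <;> simp only [mem_singleton_iff, mem_Iic] at * <;> omega)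
    (by simp)] at h2
  rw [hd.eq_of_mem hL h (k := j + 1)
    (by rintro x ((hx | hx) | hx) <;>
      simp only [mem_singleton_iff, mem_Iic] at * <;> omega)
    (by simp), union_comm {1}, h2, mul_comm] at h1
  rw [← Nat.eq_of_mul_eq_mul_right hL h1]
  have h3 := hd.pos_and_le {0} ({0} ∪ {j + 2}) {1} subset_union_left (by omega)
  exact (hd.pos_and_le _ _ {1}
    (union_subset_union_left _ subset_union_left) h3.1).2

theorem mul_mul_pow_eq (hd : IsShiftDegree d) (hL : 0 < L) (h : ∀ k, d (Iic k) {k + 1} = L)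
    {m ℓ₀ : ℕ} (hm : ∀ ℓ, 1 ≤ ℓ → d ({0} ∪ {ℓ}) {1} ≤ m) (hℓ₀ : 1 ≤ ℓ₀)
    (hℓ₀m : d ({0} ∪ {ℓ₀}) {1} = m) {ℓ : ℕ} (hℓ : ℓ₀ ≤ ℓ) :
    d {0} {ℓ} * d ({0} ∪ {ℓ₀}) (Icc 1 (ℓ₀ - 1)) * m ^ (ℓ - ℓ₀) = L ^ ℓ := by
  have attained : ∀ ℓ, ℓ₀ ≤ ℓ → d ({0} ∪ {ℓ}) {1} = m := by
    intro ℓ hℓ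
    induction ℓ, hℓ using Nat.le_induction with
    | base => exact hℓ₀m
    | succ ℓ hℓ ih =>
      obtain ⟨j, rfl⟩ := Nat.exists_eq_add_of_le' (hℓ₀.trans hℓ)
      exact le_antisymm (hm _ (by omega)) (ih ▸ hd.le_succ hL h j)
  have main : ∀ ℓ, ℓ₀ ≤ ℓ → d ({0} ∪ {ℓ}) (Icc 1 (ℓ - 1)) =
      d ({0} ∪ {ℓ₀}) (Icc 1 (ℓ₀ - 1)) * m ^ (ℓ - ℓ₀) := by
    intro ℓ hℓ
    induction ℓ, hℓ using Nat.le_induction with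
    | base => simp
    | succ ℓ hℓ ih =>
      obtain ⟨j, rfl⟩ := Nat.exists_eq_add_of_le' (hℓ₀.trans hℓ)
      have := hd.Icc_succ_eq_mul hL h j
      rw [attained _ (by omega : ℓ₀ ≤ j + 2)] at this
      simp only [Nat.add_sub_cancel] at ih ⊢
      rw [this, ih, Nat.succ_sub hℓ, pow_succ]
      ring
  obtain ⟨j, rfl⟩ := Nat.exists_eq_add_of_le' (hℓ₀.trans hℓ)
  have := hd.mul_eq_pow hL h (I := {0}) (k := 0) (by simp) (by simp) j
  rw [mul_assoc, ← main _ hℓ]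
  simpa using this

end IsShiftDegree

end ShiftDegree

section Degree

variable [Field U]

theorem fAdj_eq_sup (E : Subfield U) (s : Set U) : fAdj E s = E ⊔ Subfield.closure s := by
  rw [fAdj, IntermediateField.adjoin_toSubfield, Subfield.closure_union]
  congr 1
  have : Set.range (algebraMap E U) = (E : Set U) := Subtype.range_coe
  rw [this, Subfield.closure_eq]

theorem fAdj_fAdj (E : Subfield U) (s t : Set U) : fAdj (fAdj E s) t = fAdj E (s ∪ t) := by
  simp only [fAdj_eq_sup, Subfield.closure_union, sup_assoc]

theorem deg_eq_relfinrank (E : Subfield U) (s : Set U) :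
    deg E s = E.relfinrank (fAdj E s) := by
  have h : E ≤ fAdj E s := by rw [fAdj_eq_sup]; exact le_sup_left
  rw [Subfield.relfinrank_eq_finrank_of_le h, deg]
  have : Subfield.extendScalars h = IntermediateField.adjoin E s := SetLike.coe_injective rfl
  rw [this]

theorem deg_empty (E : Subfield U) : deg E ∅ = 1 := by
  simp [deg]

theorem deg_union (E : Subfield U) (s t : Set U) :
    deg E (s ∪ t) = deg E s * deg (fAdj E s) t := by
  simp only [deg_eq_relfinrank, fAdj_fAdj]
  refine (Subfield.relfinrank_mul_relfinrank ?_ ?_).symm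
  · rw [fAdj_eq_sup]; exact le_sup_left
  · rw [← fAdj_fAdj, fAdj_eq_sup _ t]; exact le_sup_left

theorem fAdj_map (f : U →+* U) (E : Subfield U) (s : Set U) :
    (fAdj E s).map f = fAdj (E.map f) (f '' s) := by
  simp only [fAdj_eq_sup, Subfield.map_sup, RingHom.map_field_closure]

theorem deg_map (f : U →+* U) (E : Subfield U) (s : Set U) :
    deg (E.map f) (f '' s) = deg E s := by
  rw [deg_eq_relfinrank, ← fAdj_map, Subfield.relfinrank_map_map, deg_eq_relfinrank]

theorem deg_pos_and_le {E F : Subfield U} (h : E ≤ F) (s : Set U) (hs : 0 < deg E s) :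
    0 < deg F s ∧ deg F s ≤ deg E s := by
  let _ : Algebra E F := (Subfield.inclusion h).toAlgebra
  have : IsScalarTower E F U := IsScalarTower.of_algebraMap_eq fun _ => rfl
  have hfin : FiniteDimensional E (IntermediateField.adjoin E s) :=
    Module.finite_of_finrank_pos hs
  have key := IntermediateField.adjoin_rank_le_of_isAlgebraic_right F
    (IntermediateField.adjoin E s)
  have e : IntermediateField.adjoin F (IntermediateField.adjoin E s : Set U) =
      IntermediateField.adjoin F s := by
    apply le_antisymm
    · rw [IntermediateField.adjoin_le_iff]
      have : IntermediateField.adjoin E s ≤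
          (IntermediateField.adjoin F s).restrictScalars E :=
        IntermediateField.adjoin_le_iff.2 (IntermediateField.subset_adjoin F s)
      exact this
    · exact IntermediateField.adjoin.mono _ _ _ (IntermediateField.subset_adjoin E s)
  rw [e] at key
  have hlt := Module.rank_lt_aleph0 E (IntermediateField.adjoin E s)
  have : FiniteDimensional F (IntermediateField.adjoin F s) :=
    Module.rank_lt_aleph0_iff.1 (key.trans_lt hlt)
  exact ⟨Module.finrank_pos, Cardinal.toNat_le_toNat key hlt⟩

theorem deg_pos_of_isAlgebraic (E : Subfield U) {s : Set U} (hfin : s.Finite)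
    (hs : ∀ x ∈ s, IsAlgebraic E x) : 0 < deg E s := by
  have := hfin.to_subtype
  have : FiniteDimensional E (IntermediateField.adjoin E s) :=
    IntermediateField.finiteDimensional_adjoin fun x hx => (hs x hx).isIntegral
  exact Module.finrank_pos

/-- The union of the conjugates `σ^i(s)` for `i ∈ I`. -/
def orbitUnion (σ : U ≃+* U) (s : Set U) (I : Set ℕ) : Set U := ⋃ i ∈ I, ⇑(σ ^ i) '' s

theorem orbitUnion_union (σ : U ≃+* U) (s : Set U) (I J : Set ℕ) :
    orbitUnion σ s (I ∪ J) = orbitUnion σ s I ∪ orbitUnion σ s J :=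
  biUnion_union _ _ _

theorem orbitUnion_singleton (σ : U ≃+* U) (s : Set U) (i : ℕ) :
    orbitUnion σ s {i} = ⇑(σ ^ i) '' s :=
  biUnion_singleton _ _

theorem orbitUnion_succ (σ : U ≃+* U) (s : Set U) (I : Set ℕ) :
    orbitUnion σ s (Nat.succ '' I) = σ.toRingHom '' orbitUnion σ s I := by
  simp only [orbitUnion, biUnion_image, image_iUnion₂, image_image]
  simp [pow_succ']

theorem isShiftDegree_deg (σ : U ≃+* U) (K : Subfield U) (hK : K.map σ.toRingHom = K)
    (s : Set U) :
    IsShiftDegree fun I J => deg (fAdj K (orbitUnion σ s I)) (orbitUnion σ s J) where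
  empty I := by simp [orbitUnion, deg_empty]
  union I J J' := by
    rw [orbitUnion_union, deg_union, fAdj_fAdj, orbitUnion_union]
  shift I J := by
    conv_lhs => rw [← hK, orbitUnion_succ, orbitUnion_succ, ← fAdj_map, deg_map]
  pos_and_le I I' J h := by
    refine deg_pos_and_le ?_ _
    obtain ⟨T, rfl⟩ : ∃ T, I' = I ∪ T := ⟨I', (union_eq_right.2 h).symm⟩
    rw [orbitUnion_union, ← fAdj_fAdj, fAdj_eq_sup _ (orbitUnion σ s T)]
    exact le_sup_left

end Degree

theorem tendsto_rpow_one_div_of_mul_mul_pow_eq {u : ℕ → ℕ} {L m C N : ℕ} (hL : 0 < L)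
    (hN : 1 ≤ N) (h : ∀ k, N ≤ k → u k * C * m ^ (k - N) = L ^ k) :
    Tendsto (fun k => (u k : ℝ) ^ (1 / (k : ℝ))) atTop (nhds ((L : ℝ) / (m : ℝ))) := by
  have hpos : ∀ k, N ≤ k → 0 < u k * C * m ^ (k - N) := fun k hk => by
    rw [h k hk]; exact pow_pos hL k
  have hC : 0 < C := Nat.pos_of_mul_pos_left (Nat.pos_of_mul_pos_right (hpos N le_rfl))
  have hm : 0 < m := by
    have := Nat.pos_of_mul_pos_left (hpos (N + 1) (by omega))
    simpa using this
  have hC' : (0 : ℝ) < C := by exact_mod_cast hC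
  have hm' : (0 : ℝ) < m := by exact_mod_cast hm
  have hL' : (0 : ℝ) < L := by exact_mod_cast hL
  have hc : (0 : ℝ) < (m : ℝ) ^ N / C := by positivity
  have hlim : Tendsto (fun k : ℕ => ((m : ℝ) ^ N / C) ^ (1 / (k : ℝ))) atTop (nhds 1) := by
    have := (tendsto_const_nhds (x := (m : ℝ) ^ N / C)).rpow
      (tendsto_one_div_atTop_nhds_zero_nat (𝕜 := ℝ)) (Or.inl hc.ne')
    simpa only [Real.rpow_zero] using this
  have hlim' := hlim.const_mul ((L : ℝ) / m)
  rw [mul_one] at hlim'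
  refine hlim'.congr' ?_
  filter_upwards [eventually_ge_atTop N] with k hk
  have hu : (u k : ℝ) = (L / m : ℝ) ^ k * ((m : ℝ) ^ N / C) := by
    have hk' : (u k : ℝ) * C * (m : ℝ) ^ (k - N) = (L : ℝ) ^ k := by exact_mod_cast h k hk
    have hp : (m : ℝ) ^ k = (m : ℝ) ^ (k - N) * (m : ℝ) ^ N := by
      rw [← pow_add, Nat.sub_add_cancel hk]
    rw [div_pow, ← hk', hp]
    field_simp
  have hk0 : k ≠ 0 := by omega
  rw [hu, Real.mul_rpow (by positivity) hc.le, one_div,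
    Real.pow_rpow_inv_natCast (by positivity) hk0]

/-- with `m`, `ℓ0`, `C` as in Statement 4, for every `ℓ ≥ ℓ0`,
`μ(σ^ℓ(a)/K(a))·C·m^{ℓ−ℓ0} = ld(a/K)^ℓ`; consequently
`dd(a/K) = lim μ(σ^ℓ(a)/K(a))^{1/ℓ}` exists and equals `ld(a/K)/m`. -/
theorem stmt5 [Field U] [IsAlgClosed U] (σ : U ≃+* U) (K : Subfield U)
    (hK : K.map σ.toRingHom = K) {n : ℕ} (a : Fin n → U)
    (ha : ∀ i, IsAlgebraic (fAdj K (Set.range a)) (σ (a i)))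
    (La : ℕ) (hLa : ∀ᶠ k in atTop, ldSeq σ K (Set.range a) k = La)
    (hmu : deg (fAdj K (Set.range a)) (⇑σ '' Set.range a) = La)
    (m : ℕ)
    (hm : IsGreatest {x : ℕ | ∃ ℓ : ℕ, 1 ≤ ℓ ∧
        x = deg (fAdj K (Set.range a ∪ ⇑(σ ^ ℓ) '' Set.range a)) (⇑σ '' Set.range a)} m)
    (ℓ0 : ℕ) (hℓ0 : 1 ≤ ℓ0)
    (hℓ0m : deg (fAdj K (Set.range a ∪ ⇑(σ ^ ℓ0) '' Set.range a)) (⇑σ '' Set.range a) = m)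
    (hℓ0min : ∀ ℓ : ℕ, 1 ≤ ℓ →
      deg (fAdj K (Set.range a ∪ ⇑(σ ^ ℓ) '' Set.range a)) (⇑σ '' Set.range a) = m → ℓ0 ≤ ℓ)
    (C : ℕ)
    (hC : C = deg (fAdj K (Set.range a ∪ ⇑(σ ^ ℓ0) '' Set.range a))
        (⋃ i ∈ Set.Icc 1 (ℓ0 - 1), ⇑(σ ^ i) '' Set.range a)) :
    (∀ ℓ : ℕ, ℓ0 ≤ ℓ → ddSeq σ K (Set.range a) ℓ * C * m ^ (ℓ - ℓ0) = La ^ ℓ) ∧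
    Tendsto (fun k => (ddSeq σ K (Set.range a) k : ℝ) ^ (1 / (k : ℝ))) atTop
      (nhds ((La : ℝ) / (m : ℝ))) := by
  set s := Set.range a with hs
  have hd := isShiftDegree_deg σ K hK s
  have o0 : orbitUnion σ s {0} = s := by simp [orbitUnion_singleton]
  have o1 : orbitUnion σ s {1} = ⇑σ '' s := by simp [orbitUnion_singleton]
  have o2 : ∀ ℓ, orbitUnion σ s ({0} ∪ {ℓ}) = s ∪ ⇑(σ ^ ℓ) '' s := fun ℓ => by
    rw [orbitUnion_union, o0, orbitUnion_singleton]
  have hL : 0 < La := by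
    rw [← hmu]
    refine deg_pos_of_isAlgebraic _ ((Set.finite_range a).image _) ?_
    rintro _ ⟨_, ⟨i, rfl⟩, rfl⟩
    exact ha i
  have h := hd.Iic_eq_of_eventually hL (by rw [o0, o1, hmu])
    (hLa.mono fun k hk => by rw [orbitUnion_singleton]; exact hk)
  have main : ∀ ℓ, ℓ0 ≤ ℓ → ddSeq σ K s ℓ * C * m ^ (ℓ - ℓ0) = La ^ ℓ := by
    intro ℓ hℓ
    have key := hd.mul_mul_pow_eq hL h (m := m) (ℓ₀ := ℓ0)
      (fun ℓ hℓ => hm.2 ⟨ℓ, hℓ, by rw [o2, o1]⟩) hℓ0 (by rw [o2, o1, hℓ0m]) hℓ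
    simp only [o0, o2, orbitUnion_singleton σ s ℓ] at key
    rw [hC]
    exact key
  exact ⟨main, tendsto_rpow_one_div_of_mul_mul_pow_eq hL hℓ0 main⟩
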